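/- arXiv:2101.10631 — 2 statements merged into one kernel-verified Lean document; each statement's English description precedes it below -/
import Mathlib

section
/- The Σ-protocol Σ_DecZero is complete: let q be a prime, G a commutative group of order q with generator g, and suppose the prover's private key is s ∈ ℤ/qℤ with public key k = g^s, and the common input is a pair (u, v) ∈ G × G satisfying v = u^s (i.e., (u,v) is an ElGamal encryption of zero under k). Then for every r' ∈ ℤ/qℤ and every challenge e ∈ ℤ/qℤ, the commitment X = g^{r'}, U = u^{r'} together with the response z = r' + e·s satisfies both verification equations: g^z = X · k^e and u^z = U · v^e. -/
/-- Exponentiation of a group element by an exponent in `ZMod q`; for a group of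
order `q` (so every element's order divides `q`) this is well defined as a
homomorphism in the exponent. -/
def gpow {G : Type*} [Group G] {q : ℕ} [NeZero q] (x : G) (e : ZMod q) : G :=
  x ^ e.val

theorem gpow_add {G : Type*} [Group G] {q : ℕ} [NeZero q] {x : G} (hx : x ^ q = 1)
    (a b : ZMod q) : gpow x (a + b) = gpow x a * gpow x b := by
  simp only [gpow]
  rw [ZMod.val_add, ← pow_eq_pow_mod _ hx, pow_add]

theorem gpow_mul {G : Type*} [Group G] {q : ℕ} [NeZero q] {x : G} (hx : x ^ q = 1)
    (a b : ZMod q) : gpow x (a * b) = gpow (gpow x b) a := by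
  simp only [gpow]
  rw [ZMod.val_mul, ← pow_eq_pow_mod _ hx, mul_comm, pow_mul]

/-- Completeness of the Σ-protocol Σ_DecZero. -/
theorem sigmaDecZero_completeness
    (q : ℕ) [Fact (Nat.Prime q)]
    (G : Type*) [CommGroup G] [Fintype G] (hG : Fintype.card G = q)
    (g : G) (hg : ∀ x : G, x ∈ Subgroup.zpowers g)
    (s : ZMod q) (k : G) (hk : k = gpow g s)
    (u v : G) (hv : v = gpow u s)
    (r' e : ZMod q) :
    gpow g (r' + e * s) = gpow g r' * gpow k e ∧
    gpow u (r' + e * s) = gpow u r' * gpow v e := by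
  have hpow (x : G) : x ^ q = 1 := hG ▸ pow_card_eq_one
  subst hk hv
  simp only [gpow_add (hpow _), gpow_mul (hpow _), and_self]
end

section
/- The Σ-protocol Σ_DecZero is special honest-verifier zero-knowledge: let q be a prime, G a commutative group of order q with generator g, s ∈ ℤ/qℤ, k = g^s, and (u,v) ∈ G × G with v = u^s. Fix any challenge e ∈ ℤ/qℤ. Then the pushforward of the uniform distribution on ℤ/qℤ under the honest-prover transcript map r' ↦ (g^{r'}, u^{r'}, e, r' + e·s) is equal to the pushforward of the uniform distribution on ℤ/qℤ under the simulator map z ↦ (g^z · k^{-e}, u^z · v^{-e}, e, z); in particular every simulated transcript satisfies the verification equations g^z = X·k^e and u^z = U·v^e. -/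
theorem gpow_gpow {G : Type*} [Group G] {q : ℕ} [NeZero q] {x : G} (hx : x ^ q = 1)
    (a b : ZMod q) : gpow (gpow x a) b = gpow x (a * b) := by
  simp only [gpow]
  rw [ZMod.val_mul, ← pow_eq_pow_mod _ hx, pow_mul]

theorem gpow_zero {G : Type*} [Group G] {q : ℕ} [NeZero q] (x : G) :
    gpow x (0 : ZMod q) = 1 := by
  simp [gpow]

theorem PMF.map_equiv_uniformOfFintype {α β : Type*} [Fintype α] [Nonempty α] [Fintype β]
    [Nonempty β] (f : α ≃ β) :
    (PMF.uniformOfFintype α).map f = PMF.uniformOfFintype β := by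
  classical
  ext b
  rw [PMF.map_apply, tsum_eq_single (f.symm b)]
  · simp [Fintype.card_congr f]
  · intro a ha
    rw [if_neg]
    rintro rfl
    simp at ha

/-- Special honest-verifier zero-knowledge of the Σ-protocol Σ_DecZero. -/
theorem sigmaDecZero_SHVZK
    (q : ℕ) [Fact (Nat.Prime q)]
    (G : Type*) [CommGroup G] [Fintype G] (hG : Fintype.card G = q)
    (g : G) (hg : ∀ x : G, x ∈ Subgroup.zpowers g)
    (s : ZMod q) (k : G) (hk : k = gpow g s)
    (u v : G) (hv : v = gpow u s)
    (e : ZMod q) :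
    (PMF.uniformOfFintype (ZMod q)).map
        (fun r' => (gpow g r', gpow u r', e, r' + e * s)) =
      (PMF.uniformOfFintype (ZMod q)).map
        (fun z => (gpow g z * gpow k (-e), gpow u z * gpow v (-e), e, z)) ∧
    ∀ z : ZMod q,
      gpow g z = (gpow g z * gpow k (-e)) * gpow k e ∧
      gpow u z = (gpow u z * gpow v (-e)) * gpow v e := by
  have hpow (x : G) : x ^ q = 1 := hG ▸ pow_card_eq_one
  subst hk hv
  refine ⟨?_, fun z => ?_⟩
  · conv_rhs => rw [← PMF.map_equiv_uniformOfFintype (Equiv.addRight (e * s)), PMF.map_comp]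
    congr 1
    funext r
    have hsim (x : G) : gpow x (r + e * s) * gpow (gpow x s) (-e) = gpow x r := by
      rw [gpow_gpow (hpow x), ← gpow_add (hpow x)]
      congr 1
      ring
    simp [hsim]
  · have hcancel (x y : G) : x = x * gpow y (-e) * gpow y e := by
      rw [mul_assoc, ← gpow_add (hpow y), neg_add_cancel, gpow_zero, mul_one]
    exact ⟨hcancel _ _, hcancel _ _⟩
end
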